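/- Let d ≥ 1 and q be an odd prime power with d ≡ 1 (mod 4), or d ≡ 3 (mod 4) and q ≡ 1 (mod 4). Then for every set A ⊆ F_q^d, one has (as an inequality of real numbers) SQ(A) + ZR(A) ≤ |A|²/2 + |A|²/(2q) + q^{(d+1)/2}·|A|/2 − q^{(d−1)/2}·|A|/2. -/

import Mathlib

open Finset

/-- `‖x‖ = x₁² + ⋯ + x_d²` for `x ∈ F_q^d`. -/
def normSq {d : ℕ} {F : Type} [Field F] [Fintype F] (x : Fin d → F) : F := ∑ i, x i ^ 2

/-- `SQ(A)` : the number of pairs `(x,y) ∈ A×A` with `η(‖x−y‖) = 1`,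
where `η` is the quadratic character of `F` (with `η(0) = 0`). -/
noncomputable def SQpairs {d : ℕ} {F : Type} [Field F] [Fintype F] [DecidableEq F]
    (A : Finset (Fin d → F)) : ℕ :=
  ((A ×ˢ A).filter (fun p => quadraticChar F (normSq (p.1 - p.2)) = 1)).card

/-- `ZR(A)` : the number of pairs `(x,y) ∈ A×A` with `‖x−y‖ = 0`. -/
def ZRpairs {d : ℕ} {F : Type} [Field F] [Fintype F] [DecidableEq F]
    (A : Finset (Fin d → F)) : ℕ :=
  ((A ×ˢ A).filter (fun p => normSq (p.1 - p.2) = 0)).card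

open AddChar

lemma addChar_sum {G M ι : Type*} [AddCommMonoid G] [CommMonoid M] (ψ : AddChar G M)
    (s : Finset ι) (f : ι → G) : ψ (∑ i ∈ s, f i) = ∏ i ∈ s, ψ (f i) :=
  map_prod ψ.toMonoidHom (fun i => Multiplicative.ofAdd (f i)) s

section CharacterSums

variable {F : Type} [Field F] [Fintype F] [DecidableEq F]

/-- The quadratic character of `F` with values in `ℂ`. -/
noncomputable def complexQuadraticChar (F : Type) [Field F] [Fintype F] [DecidableEq F] :
    MulChar F ℂ :=
  (quadraticChar F).ringHomComp (Int.castRingHom ℂ)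

lemma complexQuadraticChar_apply (a : F) :
    complexQuadraticChar F a = ((quadraticChar F a : ℤ) : ℂ) := rfl

lemma complexQuadraticChar_sq (a : F) :
    complexQuadraticChar F a ^ 2 = 1 - if a = 0 then 1 else 0 := by
  rw [complexQuadraticChar_apply]
  split_ifs with h
  · simp [h]
  · rw [← Int.cast_pow, quadraticChar_sq_one h]
    simp

lemma complexQuadraticChar_inv (a : F) :
    complexQuadraticChar F a⁻¹ = complexQuadraticChar F a := by
  have h : (complexQuadraticChar F)⁻¹ = complexQuadraticChar F :=
    ((quadraticChar_isQuadratic F).comp _).inv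
  conv_rhs => rw [← h, MulChar.inv_apply']

lemma complexQuadraticChar_ne_one (hF : ringChar F ≠ 2) : complexQuadraticChar F ≠ 1 :=
  (MulChar.ringHomComp_ne_one_iff (RingHom.injective_int _)).mpr (quadraticChar_ne_one hF)

lemma gaussSum_complexQuadraticChar_sq (hF : ringChar F ≠ 2) {ψ : AddChar F ℂ}
    (hψ : ψ.IsPrimitive) :
    gaussSum (complexQuadraticChar F) ψ ^ 2
      = complexQuadraticChar F (-1) * Fintype.card F :=
  gaussSum_sq (complexQuadraticChar_ne_one hF) ((quadraticChar_isQuadratic F).comp _) hψ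

lemma sum_complexQuadraticChar_mul (hF : ringChar F ≠ 2) (ψ : AddChar F ℂ) (t : F) :
    ∑ s, complexQuadraticChar F s * ψ (s * t)
      = complexQuadraticChar F t * gaussSum (complexQuadraticChar F) ψ := by
  by_cases ht : t = 0
  · simp [ht, MulChar.map_zero, MulChar.sum_eq_zero_of_ne_one (complexQuadraticChar_ne_one hF)]
  · have h := gaussSum_mulShift (complexQuadraticChar F) ψ (Units.mk0 t ht)
    have h2 := complexQuadraticChar_sq t
    rw [if_neg ht, sub_zero, sq] at h2
    rw [← h, ← mul_assoc, Units.val_mk0, h2, one_mul, gaussSum]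
    simp [mulShift_apply, mul_comm t]

lemma sum_mul_sq (hF : ringChar F ≠ 2) {ψ : AddChar F ℂ} (hψ : ψ.IsPrimitive) {s : F}
    (hs : s ≠ 0) :
    ∑ x, ψ (s * x ^ 2)
      = complexQuadraticChar F s * gaussSum (complexQuadraticChar F) ψ := by
  rw [← sum_complexQuadraticChar_mul hF,
    ← Finset.sum_fiberwise_of_maps_to (fun x _ => Finset.mem_univ (x ^ 2))]
  have h : ∀ t : F, ∑ x with x ^ 2 = t, ψ (s * x ^ 2)
      = complexQuadraticChar F t * ψ (t * s) + ψ (t * s) := by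
    intro t
    have hc := quadraticChar_card_sqrts hF t
    rw [Finset.sum_congr rfl (g := fun _ => ψ (t * s))
      (fun x hx => by rw [(Finset.mem_filter.mp hx).2, mul_comm])]
    rw [Finset.sum_const, nsmul_eq_mul, complexQuadraticChar_apply, ← add_one_mul]
    congr 1
    have : ({x : F | x ^ 2 = t}.toFinset) = Finset.univ.filter (fun x => x ^ 2 = t) := by
      ext; simp
    rw [this] at hc
    exact_mod_cast hc
  simp_rw [h, Finset.sum_add_distrib, sum_mulShift s hψ, if_neg hs]
  simp

lemma sum_mul_sq_add_mul (hF : ringChar F ≠ 2) {ψ : AddChar F ℂ} (hψ : ψ.IsPrimitive) {s : F}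
    (hs : s ≠ 0) (b : F) :
    ∑ x, ψ (s * x ^ 2 + b * x)
      = complexQuadraticChar F s * gaussSum (complexQuadraticChar F) ψ
        * ψ (s⁻¹ * (-b ^ 2 / 4)) := by
  have h2 : (2 : F) ≠ 0 := Ring.two_ne_zero hF
  rw [← sum_mul_sq hF hψ hs, Finset.sum_mul, ← Equiv.sum_comp (Equiv.addRight (-(b / (2 * s))))]
  refine Finset.sum_congr rfl fun x _ => ?_
  rw [← map_add_eq_mul]
  congr 1
  simp only [Equiv.coe_addRight]
  rw [show (4 : F) = 2 * 2 by norm_num]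
  field_simp
  ring

lemma sum_mul_normSq_add_dotProduct (hF : ringChar F ≠ 2) {ψ : AddChar F ℂ}
    (hψ : ψ.IsPrimitive) {d : ℕ} {s : F} (hs : s ≠ 0) (z : Fin d → F) :
    ∑ m : Fin d → F, ψ (s * normSq m + z ⬝ᵥ m)
      = (complexQuadraticChar F s * gaussSum (complexQuadraticChar F) ψ) ^ d
        * ψ (s⁻¹ * (-normSq z / 4)) := by
  have h1 : ∀ m : Fin d → F, ψ (s * normSq m + z ⬝ᵥ m) = ∏ i, ψ (s * m i ^ 2 + z i * m i) := by
    intro m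
    rw [← addChar_sum, normSq, dotProduct, Finset.mul_sum, Finset.sum_add_distrib]
  have h3 : s⁻¹ * (-normSq z / 4) = ∑ i, s⁻¹ * (-z i ^ 2 / 4) := by
    rw [normSq, ← Finset.mul_sum, ← Finset.sum_div, Finset.sum_neg_distrib]
  simp_rw [h1]
  rw [← Fintype.prod_sum (fun i x => ψ (s * x ^ 2 + z i * x))]
  simp_rw [sum_mul_sq_add_mul hF hψ hs]
  rw [Finset.prod_mul_distrib, Finset.prod_const, Finset.card_univ, Fintype.card_fin, h3, addChar_sum]

lemma sum_addChar_dotProduct {ψ : AddChar F ℂ} (hψ : ψ.IsPrimitive) {d : ℕ} (z : Fin d → F) :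
    ∑ m : Fin d → F, ψ (z ⬝ᵥ m) = if z = 0 then (Fintype.card F : ℂ) ^ d else 0 := by
  have hprod : ∀ m : Fin d → F, ψ (z ⬝ᵥ m) = ∏ i, ψ (m i * z i) := fun m => by
    rw [dotProduct, addChar_sum]
    simp_rw [mul_comm]
  simp_rw [hprod]
  rw [← Fintype.prod_sum (fun i x => ψ (x * z i))]
  simp_rw [sum_mulShift _ hψ]
  split_ifs with hz
  · simp [hz]
  · obtain ⟨i, hi⟩ := Function.ne_iff.mp hz
    exact Finset.prod_eq_zero (Finset.mem_univ i) (by simpa using hi)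

omit [Fintype F] [DecidableEq F] in
lemma neg_div_four_eq_zero_iff (hF : ringChar F ≠ 2) (t : F) : -t / 4 = 0 ↔ t = 0 := by
  have h2 : (2 : F) ≠ 0 := Ring.two_ne_zero hF
  have h4 : (4 : F) ≠ 0 := by
    rw [show (4 : F) = 2 * 2 by norm_num]
    exact mul_ne_zero h2 h2
  simp [h4]

lemma complexQuadraticChar_neg_div_four (hF : ringChar F ≠ 2) (t : F) :
    complexQuadraticChar F (-t / 4)
      = complexQuadraticChar F (-1) * complexQuadraticChar F t := by
  have h2 : (2 : F)⁻¹ ≠ 0 := inv_ne_zero (Ring.two_ne_zero hF)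
  have h : -t / 4 = -1 * t * (2⁻¹) ^ 2 := by
    rw [show (4 : F) = 2 ^ 2 by norm_num, div_eq_mul_inv, ← inv_pow, neg_one_mul]
  rw [h, map_mul, map_mul, map_pow, complexQuadraticChar_sq, if_neg h2]
  simp

lemma complexQuadraticChar_pow_odd (k : ℕ) (s : F) :
    complexQuadraticChar F s ^ (2 * k + 1) = complexQuadraticChar F s := by
  by_cases hs : s = 0
  · simp [hs, MulChar.map_zero]
  · rw [pow_succ, pow_mul, complexQuadraticChar_sq, if_neg hs]
    simp

lemma sum_complexQuadraticChar_normSq (hF : ringChar F ≠ 2) {ψ : AddChar F ℂ}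
    (hψ : ψ.IsPrimitive) (k : ℕ) (z : Fin (2 * k + 1) → F) :
    ∑ m : Fin (2 * k + 1) → F, complexQuadraticChar F (normSq m) * ψ (z ⬝ᵥ m)
      = gaussSum (complexQuadraticChar F) ψ ^ (2 * k)
        * ((Fintype.card F : ℂ) * (if normSq z = 0 then 1 else 0) - 1) := by
  have hG : gaussSum (complexQuadraticChar F) ψ ≠ 0 :=
    gaussSum_ne_zero_of_nontrivial (by simp) (complexQuadraticChar_ne_one hF) hψ
  apply mul_right_cancel₀ hG
  have h1 : ∀ s : F, complexQuadraticChar F s * ∑ m : Fin (2 * k + 1) → F,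
      ψ (s * normSq m + z ⬝ᵥ m) = gaussSum (complexQuadraticChar F) ψ ^ (2 * k + 1) *
        (complexQuadraticChar F s ^ 2 * ψ (s⁻¹ * (-normSq z / 4))) := by
    intro s
    by_cases hs : s = 0
    · simp [hs, MulChar.map_zero]
    · rw [sum_mul_normSq_add_dotProduct hF hψ hs, mul_pow, complexQuadraticChar_pow_odd]
      ring
  have h2 : ∑ s : F, complexQuadraticChar F s ^ 2 * ψ (s⁻¹ * (-normSq z / 4))
      = (Fintype.card F : ℂ) * (if normSq z = 0 then 1 else 0) - 1 := by
    rw [← (inv_involutive (G := F)).bijective.sum_comp]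
    simp only [inv_inv, complexQuadraticChar_inv, complexQuadraticChar_sq,
      sub_mul, Finset.sum_sub_distrib, one_mul, sum_mulShift _ hψ, neg_div_four_eq_zero_iff hF]
    simp
  calc _ = ∑ s, complexQuadraticChar F s * ∑ m : Fin (2 * k + 1) → F,
        ψ (s * normSq m + z ⬝ᵥ m) := by
        simp_rw [Finset.sum_mul, Finset.mul_sum]
        rw [Finset.sum_comm]
        refine Finset.sum_congr rfl fun m _ => ?_
        rw [mul_right_comm, ← sum_complexQuadraticChar_mul hF, Finset.sum_mul]
        simp_rw [map_add_eq_mul, mul_assoc]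
    _ = _ := by
        simp_rw [h1, ← Finset.mul_sum, h2]
        ring

lemma card_mul_sum_normSq_eq_zero (hF : ringChar F ≠ 2) {ψ : AddChar F ℂ}
    (hψ : ψ.IsPrimitive) (k : ℕ) (z : Fin (2 * k + 1) → F) :
    ∑ m : Fin (2 * k + 1) → F, ((Fintype.card F : ℂ) * if normSq m = 0 then 1 else 0)
        * ψ (z ⬝ᵥ m)
      = (if z = 0 then (Fintype.card F : ℂ) ^ (2 * k + 1) else 0)
        + gaussSum (complexQuadraticChar F) ψ ^ (2 * k + 2)
          * (complexQuadraticChar F (-1) * complexQuadraticChar F (normSq z)) := by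
  have h1 : ∀ s : F, ∑ m : Fin (2 * k + 1) → F, ψ (s * normSq m + z ⬝ᵥ m)
      = (if s = 0 then (if z = 0 then (Fintype.card F : ℂ) ^ (2 * k + 1) else 0) else 0)
        + gaussSum (complexQuadraticChar F) ψ ^ (2 * k + 1) *
        (complexQuadraticChar F s * ψ (s⁻¹ * (-normSq z / 4))) := by
    intro s
    by_cases hs : s = 0
    · simp [hs, MulChar.map_zero, sum_addChar_dotProduct hψ]
    · rw [sum_mul_normSq_add_dotProduct hF hψ hs, mul_pow, complexQuadraticChar_pow_odd,
        if_neg hs]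
      ring
  have h2 : ∑ s : F, complexQuadraticChar F s * ψ (s⁻¹ * (-normSq z / 4))
      = complexQuadraticChar F (-1) * complexQuadraticChar F (normSq z)
        * gaussSum (complexQuadraticChar F) ψ := by
    rw [← (inv_involutive (G := F)).bijective.sum_comp]
    simp only [inv_inv, complexQuadraticChar_inv]
    rw [sum_complexQuadraticChar_mul hF, complexQuadraticChar_neg_div_four hF]
  calc _ = ∑ s : F, ∑ m : Fin (2 * k + 1) → F, ψ (s * normSq m + z ⬝ᵥ m) := by
        rw [Finset.sum_comm]
        refine Finset.sum_congr rfl fun m _ => ?_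
        simp_rw [map_add_eq_mul, ← Finset.sum_mul, sum_mulShift _ hψ]
        simp
    _ = _ := by
        simp_rw [h1, Finset.sum_add_distrib, ← Finset.mul_sum, h2]
        simp
        ring

/-- The Fourier multiplier of the kernel `η(‖z‖) + 1_{‖z‖ = 0}`, up to scaling and its value
at the trivial frequency. -/
noncomputable def distanceMultiplier {d : ℕ} (m : Fin d → F) : ℝ :=
  (quadraticChar F (normSq m) : ℝ) + (Fintype.card F : ℝ) * (if normSq m = 0 then 1 else 0) - 1

lemma distanceMultiplier_le {d : ℕ} (m : Fin d → F) :
    distanceMultiplier m ≤ (Fintype.card F : ℝ) - 1 := by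
  have hq : (1 : ℝ) ≤ Fintype.card F := by exact_mod_cast Fintype.card_pos
  rw [distanceMultiplier]
  by_cases h : normSq m = 0
  · simp [h]
  · rcases quadraticChar_dichotomy h with h' | h' <;> rw [h', if_neg h] <;> push_cast <;> linarith

lemma sum_distanceMultiplier (hF : ringChar F ≠ 2) {ψ : AddChar F ℂ} (hψ : ψ.IsPrimitive)
    {k : ℕ} (hk : quadraticChar F (-1) ^ k = 1) (z : Fin (2 * k + 1) → F) :
    ∑ m : Fin (2 * k + 1) → F, (distanceMultiplier m : ℂ) * ψ (z ⬝ᵥ m)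
      = (Fintype.card F : ℂ) ^ (k + 1)
          * ((quadraticChar F (normSq z) : ℂ) + if normSq z = 0 then 1 else 0)
        - (Fintype.card F : ℂ) ^ k := by
  have hk' : complexQuadraticChar F (-1) ^ k = 1 := by
    rw [complexQuadraticChar_apply, ← Int.cast_pow, hk, Int.cast_one]
  have hG : gaussSum (complexQuadraticChar F) ψ ^ (2 * k) = (Fintype.card F : ℂ) ^ k := by
    rw [pow_mul, gaussSum_complexQuadraticChar_sq hF hψ, mul_pow, hk', one_mul]
  have hn : complexQuadraticChar F (-1) ^ 2 = 1 := by
    rw [complexQuadraticChar_sq]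
    simp
  have hm : ∀ m : Fin (2 * k + 1) → F, (distanceMultiplier m : ℂ) * ψ (z ⬝ᵥ m)
      = complexQuadraticChar F (normSq m) * ψ (z ⬝ᵥ m)
        + ((Fintype.card F : ℂ) * if normSq m = 0 then 1 else 0) * ψ (z ⬝ᵥ m)
        - ψ (z ⬝ᵥ m) := by
    intro m
    rw [distanceMultiplier, complexQuadraticChar_apply]
    push_cast [apply_ite Complex.ofReal]
    ring
  simp_rw [hm, Finset.sum_sub_distrib, Finset.sum_add_distrib]
  rw [sum_complexQuadraticChar_normSq hF hψ, card_mul_sum_normSq_eq_zero hF hψ,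
    sum_addChar_dotProduct hψ, pow_add _ (2 * k) 2, hG, gaussSum_complexQuadraticChar_sq hF hψ,
    ← complexQuadraticChar_apply]
  linear_combination (Fintype.card F : ℂ) ^ (k + 1) * complexQuadraticChar F (normSq z) * hn

omit [DecidableEq F] in
lemma sum_mul_dotProduct_sub (ψ : AddChar F ℂ) {d : ℕ} (w : (Fin d → F) → ℝ)
    (A : Finset (Fin d → F)) :
    ∑ x ∈ A, ∑ y ∈ A, ∑ m, (w m : ℂ) * ψ ((x - y) ⬝ᵥ m)
      = ((∑ m, w m * Complex.normSq (∑ x ∈ A, ψ (x ⬝ᵥ m)) : ℝ) : ℂ) := by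
  have h : ∀ m, ((w m * Complex.normSq (∑ x ∈ A, ψ (x ⬝ᵥ m)) : ℝ) : ℂ)
      = ∑ x ∈ A, ∑ y ∈ A, (w m : ℂ) * ψ ((x - y) ⬝ᵥ m) := by
    intro m
    rw [Complex.ofReal_mul, ← Complex.mul_conj, map_sum, Finset.sum_mul_sum, Finset.mul_sum]
    refine Finset.sum_congr rfl fun x _ => ?_
    rw [Finset.mul_sum]
    refine Finset.sum_congr rfl fun y _ => ?_
    rw [← map_neg_eq_conj, ← map_add_eq_mul, sub_dotProduct, sub_eq_add_neg]
  rw [Complex.ofReal_sum, Finset.sum_congr rfl fun m _ => h m, Finset.sum_comm (s := Finset.univ)]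
  exact Finset.sum_congr rfl fun x _ => Finset.sum_comm

lemma sum_quadraticChar_add_indicator_le (hF : ringChar F ≠ 2) {k : ℕ}
    (hk : quadraticChar F (-1) ^ k = 1) (A : Finset (Fin (2 * k + 1) → F)) :
    ∑ x ∈ A, ∑ y ∈ A, ((quadraticChar F (normSq (x - y)) : ℝ)
        + if normSq (x - y) = 0 then 1 else 0)
      ≤ (A.card : ℝ) ^ 2 / Fintype.card F
        + ((Fintype.card F : ℝ) - 1) * (Fintype.card F : ℝ) ^ k * A.card := by
  obtain ⟨ψ, hψ⟩ : ∃ ψ : AddChar F ℂ, ψ.IsPrimitive :=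
    ⟨_, FiniteField.primitiveChar_to_Complex_isPrimitive F⟩
  have hq : (0 : ℝ) < Fintype.card F := by exact_mod_cast Fintype.card_pos
  set q : ℝ := (Fintype.card F : ℝ) with hqdef
  set S : ℝ := ∑ x ∈ A, ∑ y ∈ A, ((quadraticChar F (normSq (x - y)) : ℝ)
        + if normSq (x - y) = 0 then 1 else 0) with hS
  have hker : ∀ z : Fin (2 * k + 1) → F,
      ∑ m, ((q - 1 - distanceMultiplier m : ℝ) : ℂ) * ψ (z ⬝ᵥ m)
        = ((if z = 0 then (q - 1) * q ^ (2 * k + 1) else 0 : ℝ) : ℂ)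
          - ((q ^ (k + 1) * ((quadraticChar F (normSq z) : ℝ)
            + if normSq z = 0 then 1 else 0) : ℝ) : ℂ) + ((q ^ k : ℝ) : ℂ) := by
    intro z
    have hm : ∀ m, ((q - 1 - distanceMultiplier m : ℝ) : ℂ) * ψ (z ⬝ᵥ m)
        = ((q - 1 : ℝ) : ℂ) * ψ (z ⬝ᵥ m) - (distanceMultiplier m : ℂ) * ψ (z ⬝ᵥ m) := by
      intro m
      push_cast
      ring
    simp_rw [hm]
    rw [Finset.sum_sub_distrib, ← Finset.mul_sum, sum_addChar_dotProduct hψ,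
      sum_distanceMultiplier hF hψ hk]
    split_ifs <;> simp [hqdef] <;> ring
  have hsum := sum_mul_dotProduct_sub ψ (fun m => q - 1 - distanceMultiplier m) A
  simp_rw [hker] at hsum
  have hreal : (q - 1) * q ^ (2 * k + 1) * A.card - q ^ (k + 1) * S + q ^ k * A.card ^ 2
      = ∑ m, (q - 1 - distanceMultiplier m) * Complex.normSq (∑ x ∈ A, ψ (x ⬝ᵥ m)) := by
    have hsum' : ∑ x ∈ A, ∑ y ∈ A, ((if x - y = 0 then (q - 1) * q ^ (2 * k + 1) else 0)
        - q ^ (k + 1) * ((quadraticChar F (normSq (x - y)) : ℝ)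
          + if normSq (x - y) = 0 then 1 else 0) + q ^ k)
        = ∑ m, (q - 1 - distanceMultiplier m) * Complex.normSq (∑ x ∈ A, ψ (x ⬝ᵥ m)) := by
      exact_mod_cast hsum
    rw [← hsum']
    simp_rw [Finset.sum_add_distrib, Finset.sum_sub_distrib, ← Finset.mul_sum,
      Finset.sum_add_distrib, sub_eq_zero, Finset.sum_ite_eq]
    rw [Finset.sum_congr rfl (fun x hx => if_pos hx), hS]
    simp [Finset.sum_add_distrib]
    ring
  have hnonneg : 0 ≤ ∑ m, (q - 1 - distanceMultiplier m)
      * Complex.normSq (∑ x ∈ A, ψ (x ⬝ᵥ m)) :=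
    Finset.sum_nonneg fun m _ => mul_nonneg (sub_nonneg.mpr (distanceMultiplier_le m))
      (Complex.normSq_nonneg _)
  rw [← hreal] at hnonneg
  have hpos : 0 < q ^ (k + 1) := by positivity
  refine le_of_mul_le_mul_left ?_ hpos
  have : q ^ (k + 1) * ((A.card : ℝ) ^ 2 / q + (q - 1) * q ^ k * A.card)
      = (q - 1) * q ^ (2 * k + 1) * A.card + q ^ k * A.card ^ 2 := by
    field_simp
    ring
  linarith

lemma two_mul_SQpairs_add_ZRpairs {d : ℕ} (A : Finset (Fin d → F)) :
    2 * ((SQpairs A : ℝ) + ZRpairs A) = (A.card : ℝ) ^ 2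
      + ∑ x ∈ A, ∑ y ∈ A, ((quadraticChar F (normSq (x - y)) : ℝ)
        + if normSq (x - y) = 0 then 1 else 0) := by
  have hcard : (A.card : ℝ) ^ 2 = ∑ p ∈ A ×ˢ A, (1 : ℝ) := by
    simp [sq]
  rw [SQpairs, ZRpairs, Finset.card_filter, Finset.card_filter, hcard, ← Finset.sum_product']
  push_cast
  rw [← Finset.sum_add_distrib, ← Finset.sum_add_distrib, Finset.mul_sum]
  refine Finset.sum_congr rfl fun p _ => ?_
  by_cases h : normSq (p.1 - p.2) = 0
  · simp [h]
    norm_num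
  · rcases quadraticChar_dichotomy h with h' | h' <;> rw [h', if_neg h] <;> norm_num

end CharacterSums

theorem distance_structure_odd_plus (q d : ℕ) (F : Type) [Field F] [Fintype F] [DecidableEq F]
    (hcard : Fintype.card F = q) (hodd : Odd q)
    (hd : d % 4 = 1 ∨ (d % 4 = 3 ∧ q % 4 = 1)) (hd1 : 1 ≤ d)
    (A : Finset (Fin d → F)) :
    (SQpairs A : ℝ) + (ZRpairs A : ℝ) ≤ (A.card : ℝ) ^ 2 / 2 + (A.card : ℝ) ^ 2 / (2 * q)
      + (q : ℝ) ^ ((d + 1) / 2) * (A.card : ℝ) / 2 - (q : ℝ) ^ ((d - 1) / 2) * (A.card : ℝ) / 2 := by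
  obtain ⟨k, rfl⟩ : ∃ k, d = 2 * k + 1 := ⟨d / 2, by omega⟩
  subst hcard
  have hF : ringChar F ≠ 2 := by
    intro h
    have := FiniteField.even_card_of_char_two h
    rw [Nat.odd_iff] at hodd
    omega
  have hk : quadraticChar F (-1) ^ k = 1 := by
    rcases hd with h | ⟨-, h⟩
    · obtain ⟨j, rfl⟩ : ∃ j, k = 2 * j := ⟨k / 2, by omega⟩
      rw [pow_mul, quadraticChar_sq_one (neg_ne_zero.mpr one_ne_zero), one_pow]
    · have hsq : IsSquare (-1 : F) := FiniteField.isSquare_neg_one_iff.mpr (by omega)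
      rw [(quadraticChar_one_iff_isSquare (neg_ne_zero.mpr one_ne_zero)).mpr hsq, one_pow]
  have hle := sum_quadraticChar_add_indicator_le hF hk A
  have htwo := two_mul_SQpairs_add_ZRpairs A
  have hdiv : (A.card : ℝ) ^ 2 / (2 * (Fintype.card F : ℝ))
      = (A.card : ℝ) ^ 2 / Fintype.card F / 2 := by
    rw [div_div, mul_comm (2 : ℝ)]
  rw [show (2 * k + 1 + 1) / 2 = k + 1 by omega, show (2 * k + 1 - 1) / 2 = k by omega, hdiv,
    pow_succ (Fintype.card F : ℝ) k]
  linarith
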